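/- arXiv:0802.2092 — 5 statements merged into one kernel-verified Lean document; each statement's English description precedes it below -/
import Mathlib

section
/- Let Q be a positive semidefinite real symmetric 4×4 matrix whose kernel contains a nonzero vector n = (n₀, n⃗) with n₀ = 0. Then for every qubit state ρ with vector x (x₀ = 1, x·x ≥ 0) there exist two pure states π₁, π₂ with vectors y, z (y₀ = z₀ = 1, y·y = z·z = 0) and p ∈ [0,1] such that ρ = p·π₁ + (1−p)·π₂, x = p·y + (1−p)·z, and q(x) = q(y) = q(z), where q(x) = xᵀQx. In particular √(q(x)) = p·√(q(y)) + (1−p)·√(q(z)), and √q restricted to the state space is a flat convex roof. -/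
open scoped Matrix ComplexOrder
open Matrix

noncomputable section

/-- Pauli matrix σ₁ -/
def pauli1 : Matrix (Fin 2) (Fin 2) ℂ := !![0, 1; 1, 0]
/-- Pauli matrix σ₂ -/
def pauli2 : Matrix (Fin 2) (Fin 2) ℂ := !![0, -Complex.I; Complex.I, 0]
/-- Pauli matrix σ₃ -/
def pauli3 : Matrix (Fin 2) (Fin 2) ℂ := !![1, 0; 0, -1]

/-- The map x ↦ ½(x₀ I + x₁σ₁ + x₂σ₂ + x₃σ₃). -/
def toMat (x : Fin 4 → ℝ) : Matrix (Fin 2) (Fin 2) ℂ :=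
  (1 / 2 : ℂ) • ((x 0 : ℂ) • (1 : Matrix (Fin 2) (Fin 2) ℂ) +
    (x 1 : ℂ) • pauli1 + (x 2 : ℂ) • pauli2 + (x 3 : ℂ) • pauli3)

/-- Minkowski inner product on ℝ⁴. -/
def mink (x y : Fin 4 → ℝ) : ℝ := x 0 * y 0 - x 1 * y 1 - x 2 * y 2 - x 3 * y 3

/-- Bloch-picture action of a trace-preserving linear map:
(x₀, x⃗) ↦ (x₀, x₀ t⃗ + Λ x⃗). -/
def phiVec (t : Fin 3 → ℝ) (Λ : Matrix (Fin 3) (Fin 3) ℝ) (x : Fin 4 → ℝ) : Fin 4 → ℝ :=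
  ![x 0,
    x 0 * t 0 + ∑ j : Fin 3, Λ 0 j * x j.succ,
    x 0 * t 1 + ∑ j : Fin 3, Λ 1 j * x j.succ,
    x 0 * t 2 + ∑ j : Fin 3, Λ 2 j * x j.succ]

/-- The quadratic form q_w(x) = Φ(x)·Φ(x) − w x·x. -/
def qform (t : Fin 3 → ℝ) (Λ : Matrix (Fin 3) (Fin 3) ℝ) (w : ℝ) (x : Fin 4 → ℝ) : ℝ :=
  mink (phiVec t Λ x) (phiVec t Λ x) - w * mink x x

/-- Positivity of the map in the Bloch picture: positive semidefinite matrices are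
mapped to positive semidefinite matrices. -/
def IsPosMap (t : Fin 3 → ℝ) (Λ : Matrix (Fin 3) (Fin 3) ℝ) : Prop :=
  ∀ x : Fin 4 → ℝ, (toMat x).PosSemidef → (toMat (phiVec t Λ x)).PosSemidef

/-- x is the Bloch vector of a qubit state. -/
def IsStateVec (x : Fin 4 → ℝ) : Prop := (toMat x).PosSemidef ∧ x 0 = 1

/-- x is the Bloch vector of a pure qubit state (determinant zero, i.e. x·x = 0). -/
def IsPureVec (x : Fin 4 → ℝ) : Prop := (toMat x).PosSemidef ∧ x 0 = 1 ∧ mink x x = 0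

/-- Concurrence of a pure state: C_Φ(π) = 2√(det Φ(π)). -/
def pureConc (t : Fin 3 → ℝ) (Λ : Matrix (Fin 3) (Fin 3) ℝ) (y : Fin 4 → ℝ) : ℝ :=
  2 * Real.sqrt ((toMat (phiVec t Λ y)).det.re)

/-- Concurrence of a (mixed) state with Bloch vector x: the infimum over finite
convex decompositions into pure states of the average pure-state concurrence. -/
def conc (t : Fin 3 → ℝ) (Λ : Matrix (Fin 3) (Fin 3) ℝ) (x : Fin 4 → ℝ) : ℝ :=
  sInf {c : ℝ | ∃ (k : ℕ) (p : Fin k → ℝ) (y : Fin k → (Fin 4 → ℝ)),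
    (∀ j, 0 < p j) ∧ (∑ j, p j) = 1 ∧ (∀ j, IsPureVec (y j)) ∧
    (∀ i, (∑ j, p j * y j i) = x i) ∧ c = ∑ j, p j * pureConc t Λ (y j)}

end

lemma det_toMat (x : Fin 4 → ℝ) : (toMat x).det = ((mink x x / 4 : ℝ) : ℂ) := by
  simp only [toMat, pauli1, pauli2, pauli3, mink, Matrix.det_fin_two]
  simp
  ring_nf
  simp only [Complex.I_sq]
  ring

lemma mink_self_nonneg_of_posSemidef {x : Fin 4 → ℝ} (h : (toMat x).PosSemidef) :
    0 ≤ mink x x := by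
  have h' := h.det_nonneg
  rw [det_toMat, Complex.zero_le_real] at h'
  linarith

lemma isHermitian_toMat (x : Fin 4 → ℝ) : (toMat x).IsHermitian := by
  ext i j
  fin_cases i <;> fin_cases j <;>
    simp [toMat, pauli1, pauli2, pauli3, Matrix.conjTranspose_apply]
  all_goals ring

lemma toMat_mul_self {x : Fin 4 → ℝ} (h0 : x 0 = 1) (h : mink x x = 0) :
    toMat x * toMat x = toMat x := by
  have hC : (1 : ℂ) - x 1 * x 1 - x 2 * x 2 - x 3 * x 3 = 0 := by
    simp only [mink, h0] at h
    exact_mod_cast (by linarith : (1 : ℝ) - x 1 * x 1 - x 2 * x 2 - x 3 * x 3 = 0)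
  have hI := Complex.I_mul_I
  ext i j
  fin_cases i <;> fin_cases j <;>
    simp [toMat, pauli1, pauli2, pauli3, Matrix.mul_apply, Fin.sum_univ_two, h0]
  · linear_combination -(1 / 4) * hC - (x 2 : ℂ) ^ 2 / 4 * hI
  · ring
  · ring
  · linear_combination -(1 / 4) * hC - (x 2 : ℂ) ^ 2 / 4 * hI

lemma isPureVec_of_mink_self_eq_zero {x : Fin 4 → ℝ} (h0 : x 0 = 1) (h : mink x x = 0) :
    IsPureVec x := by
  refine ⟨?_, h0, h⟩
  have := Matrix.posSemidef_conjTranspose_mul_self (toMat x)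
  rwa [(isHermitian_toMat x).eq, toMat_mul_self h0 h] at this

/-- A real quadratic with positive leading coefficient that is nonpositive at `0` has two roots
whose convex hull contains `0`. -/
lemma exists_quadratic_roots_convex_combination_eq_zero {a b c : ℝ} (ha : 0 < a) (hc : c ≤ 0) :
    ∃ p s r : ℝ, 0 ≤ p ∧ p ≤ 1 ∧ p * s + (1 - p) * r = 0 ∧
      a * s ^ 2 + 2 * b * s + c = 0 ∧ a * r ^ 2 + 2 * b * r + c = 0 := by
  have hac : 0 ≤ -(a * c) := by nlinarith
  have hD : 0 ≤ b ^ 2 - a * c := by nlinarith [sq_nonneg b]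
  set d := √(b ^ 2 - a * c) with hd
  have hdd : d ^ 2 = b ^ 2 - a * c := Real.sq_sqrt hD
  have habs : |b| ≤ d := Real.abs_le_sqrt (by linarith)
  obtain ⟨hb₁, hb₂⟩ := abs_le.mp habs
  have hd0 : 0 ≤ d := Real.sqrt_nonneg _
  refine ⟨(b + d) / (2 * d), (-b + d) / a, (-b - d) / a, by apply div_nonneg <;> linarith,
    div_le_one_of_le₀ (by linarith) (by linarith), ?_, ?_, ?_⟩
  · rcases hd0.eq_or_lt with h | h
    · have hb : b = 0 := by linarith
      simp [← h, hb]
    · field_simp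
      ring
  · field_simp
    linear_combination hdd
  · field_simp
    linear_combination hdd

lemma dotProduct_mulVec_add_smul_of_mulVec_eq_zero {ι R : Type*} [Fintype ι] [CommRing R]
    {Q : Matrix ι ι R} (hQ : Q.IsSymm) {n : ι → R} (hn : Q *ᵥ n = 0) (x : ι → R) (s : R) :
    (x + s • n) ⬝ᵥ Q *ᵥ (x + s • n) = x ⬝ᵥ Q *ᵥ x := by
  have h : n ⬝ᵥ Q *ᵥ x = 0 := by
    rw [Matrix.dotProduct_mulVec, ← Matrix.mulVec_transpose, hQ.eq, hn, zero_dotProduct]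
  simp [Matrix.mulVec_add, Matrix.mulVec_smul, hn, add_dotProduct, smul_dotProduct, h]

lemma toMat_smul_add_smul (a b : ℝ) (y z : Fin 4 → ℝ) :
    toMat (a • y + b • z) = (a : ℂ) • toMat y + (b : ℂ) • toMat z := by
  simp only [toMat, Pi.add_apply, Pi.smul_apply, smul_eq_mul, Complex.ofReal_add,
    Complex.ofReal_mul]
  module

/-- if Q is positive semidefinite and its kernel contains a nonzero
vector n with n₀ = 0, then every qubit state decomposes into (at most) two pure
states along which the quadratic form q(x) = xᵀQx is constant; hence
√(q(x)) = p √(q(y)) + (1−p) √(q(z)) and √q is a flat convex roof on the state space. -/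
theorem stmt6 (Q : Matrix (Fin 4) (Fin 4) ℝ) (hpsd : Q.PosSemidef)
    (n : Fin 4 → ℝ) (hn : n ≠ 0) (hker : Q.mulVec n = 0) (hn0 : n 0 = 0)
    (x : Fin 4 → ℝ) (hx : IsStateVec x) :
    ∃ (p : ℝ) (y z : Fin 4 → ℝ), 0 ≤ p ∧ p ≤ 1 ∧
      IsPureVec y ∧ IsPureVec z ∧
      x = p • y + (1 - p) • z ∧
      toMat x = (p : ℂ) • toMat y + ((1 - p : ℝ) : ℂ) • toMat z ∧
      x ⬝ᵥ Q.mulVec x = y ⬝ᵥ Q.mulVec y ∧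
      x ⬝ᵥ Q.mulVec x = z ⬝ᵥ Q.mulVec z ∧
      Real.sqrt (x ⬝ᵥ Q.mulVec x) =
        p * Real.sqrt (y ⬝ᵥ Q.mulVec y) + (1 - p) * Real.sqrt (z ⬝ᵥ Q.mulVec z) := by
  obtain ⟨hxp, hx0⟩ := hx
  have hc : x 1 ^ 2 + x 2 ^ 2 + x 3 ^ 2 - 1 ≤ 0 := by
    have := mink_self_nonneg_of_posSemidef hxp
    simp only [mink, hx0] at this
    linarith
  have ha : 0 < n 1 ^ 2 + n 2 ^ 2 + n 3 ^ 2 := by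
    refine lt_of_le_of_ne (by positivity) fun h => hn ?_
    have h1 : n 1 = 0 := by nlinarith [sq_nonneg (n 1), sq_nonneg (n 2), sq_nonneg (n 3)]
    have h2 : n 2 = 0 := by nlinarith [sq_nonneg (n 1), sq_nonneg (n 2), sq_nonneg (n 3)]
    have h3 : n 3 = 0 := by nlinarith [sq_nonneg (n 1), sq_nonneg (n 2), sq_nonneg (n 3)]
    ext i
    fin_cases i <;> simp [hn0, h1, h2, h3]
  obtain ⟨p, s, r, hp0, hp1, hpsr, hs, hr⟩ :=
    exists_quadratic_roots_convex_combination_eq_zero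
      (b := x 1 * n 1 + x 2 * n 2 + x 3 * n 3) ha hc
  have hpure (u : ℝ) (hu : (n 1 ^ 2 + n 2 ^ 2 + n 3 ^ 2) * u ^ 2 +
      2 * (x 1 * n 1 + x 2 * n 2 + x 3 * n 3) * u + (x 1 ^ 2 + x 2 ^ 2 + x 3 ^ 2 - 1) = 0) :
      IsPureVec (x + u • n) := by
    apply isPureVec_of_mink_self_eq_zero
    · simp [hn0, hx0]
    · simp only [mink, Pi.add_apply, Pi.smul_apply, smul_eq_mul, hn0, hx0]
      linear_combination -hu
  have hsymm : Q.IsSymm := by simpa [Matrix.IsHermitian, Matrix.IsSymm] using hpsd.isHermitian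
  have hq (u : ℝ) := dotProduct_mulVec_add_smul_of_mulVec_eq_zero hsymm hker x u
  have hx' : x = p • (x + s • n) + (1 - p) • (x + r • n) := by
    ext i
    simp only [Pi.add_apply, Pi.smul_apply, smul_eq_mul]
    linear_combination -n i * hpsr
  refine ⟨p, x + s • n, x + r • n, hp0, hp1, hpure s hs, hpure r hr, hx', ?_, (hq s).symm,
    (hq r).symm, ?_⟩
  · rw [← toMat_smul_add_smul, ← hx']
  · rw [hq s, hq r]
    ring
end

section
/- (Theorem 3, uniqueness) Let Φ be a positive trace-preserving real-linear map on Hermitian 2×2 matrices. There is at most one w ∈ ℝ such that the matrix Q_w of the quadratic form q_w(x) = Φ(x)·Φ(x) − w x·x is positive semidefinite and its kernel contains a nonzero vector n with n·n ≤ 0. -/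
open scoped Matrix ComplexOrder
open Matrix

/-- Adding a kernel vector of a symmetric matrix does not change its quadratic form. -/
theorem dotProduct_mulVec_add_of_mulVec_eq_zero {ι : Type*} [Fintype ι] {Q : Matrix ι ι ℝ}
    (hQ : Q.IsSymm) {n : ι → ℝ} (hn : Q *ᵥ n = 0) (m : ι → ℝ) :
    (n + m) ⬝ᵥ Q *ᵥ (n + m) = m ⬝ᵥ Q *ᵥ m := by
  have hn' : n ᵥ* Q = 0 := by rw [← mulVec_transpose, hQ.eq, hn]
  rw [mulVec_add, hn, zero_add, add_dotProduct, dotProduct_mulVec n, hn', zero_dotProduct, zero_add]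

/-- If `Q_w` and `Q_w'` are positive semidefinite and the kernel of `Q_w'` contains a nonzero
vector that is not timelike, then `w' ≤ w`. -/
theorem le_of_posSemidef_of_mink_nonpos {t : Fin 3 → ℝ} {Λ : Matrix (Fin 3) (Fin 3) ℝ}
    {w w' : ℝ} {Q Q' : Matrix (Fin 4) (Fin 4) ℝ}
    (hsymm : Q.IsSymm) (hsymm' : Q'.IsSymm)
    (hrepr : ∀ x : Fin 4 → ℝ, x ⬝ᵥ Q *ᵥ x = qform t Λ w x)
    (hrepr' : ∀ x : Fin 4 → ℝ, x ⬝ᵥ Q' *ᵥ x = qform t Λ w' x)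
    (hpsd : Q.PosSemidef) {n : Fin 4 → ℝ} (hn : n ≠ 0) (hker : Q' *ᵥ n = 0)
    (hnn : mink n n ≤ 0) : w' ≤ w := by
  by_contra! hlt
  have hdiff (x : Fin 4 → ℝ) : x ⬝ᵥ Q *ᵥ x = x ⬝ᵥ Q' *ᵥ x + (w' - w) * mink x x := by
    rw [hrepr, hrepr', qform, qform]
    ring
  have hval : n ⬝ᵥ Q *ᵥ n = (w' - w) * mink n n := by
    rw [hdiff, hker, dotProduct_zero, zero_add]
  have hnonneg : 0 ≤ n ⬝ᵥ Q *ᵥ n := by simpa using hpsd.dotProduct_mulVec_nonneg n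
  have hnull : mink n n = 0 := by nlinarith
  have hker₀ : Q *ᵥ n = 0 := by
    rw [← hpsd.dotProduct_mulVec_zero_iff]
    simpa [hnull] using hval
  set m : Fin 4 → ℝ := ![n 0, -n 1, -n 2, -n 3] with hm
  have hsum : mink (n + m) (n + m) = mink m m := by
    have h := hdiff (n + m)
    rw [dotProduct_mulVec_add_of_mulVec_eq_zero hsymm hker₀,
      dotProduct_mulVec_add_of_mulVec_eq_zero hsymm' hker, hdiff m] at h
    exact (mul_left_cancel₀ (sub_pos.mpr hlt).ne' (add_left_cancel h)).symm
  simp only [mink, hm, Pi.add_apply, cons_val] at hsum hnull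
  refine hn (funext fun i => ?_)
  refine pow_eq_zero_iff two_ne_zero |>.mp ?_
  fin_cases i <;> simp only [Fin.zero_eta, Fin.mk_one, Fin.reduceFinMk] <;>
    nlinarith [sq_nonneg (n 0), sq_nonneg (n 1), sq_nonneg (n 2), sq_nonneg (n 3)]

/-- Theorem 3, uniqueness: there is at most one w such that the
symmetric matrix Q_w of the form q_w(x) = Φ(x)·Φ(x) − w x·x is positive semidefinite
and its kernel contains a nonzero vector n with n·n ≤ 0. -/
theorem stmt10 (t : Fin 3 → ℝ) (Λ : Matrix (Fin 3) (Fin 3) ℝ) (hpos : IsPosMap t Λ)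
    (w w' : ℝ) (Q Q' : Matrix (Fin 4) (Fin 4) ℝ)
    (hsymm : Q.IsSymm) (hsymm' : Q'.IsSymm)
    (hrepr : ∀ x : Fin 4 → ℝ, x ⬝ᵥ Q.mulVec x = qform t Λ w x)
    (hrepr' : ∀ x : Fin 4 → ℝ, x ⬝ᵥ Q'.mulVec x = qform t Λ w' x)
    (hpsd : Q.PosSemidef) (hpsd' : Q'.PosSemidef)
    (n : Fin 4 → ℝ) (hn : n ≠ 0) (hker : Q.mulVec n = 0) (hnn : mink n n ≤ 0)
    (n' : Fin 4 → ℝ) (hn' : n' ≠ 0) (hker' : Q'.mulVec n' = 0) (hnn' : mink n' n' ≤ 0) :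
    w = w' := by
  exact le_antisymm
    (le_of_posSemidef_of_mink_nonpos hsymm' hsymm hrepr' hrepr hpsd' hn hker hnn)
    (le_of_posSemidef_of_mink_nonpos hsymm hsymm' hrepr hrepr' hpsd hn' hker' hnn')
end

section
/- Let Q₀ be a real symmetric 4×4 matrix, η = diag(1,−1,−1,−1), and suppose w₁ < w₂ are real numbers such that both Q₀ − w₁η and Q₀ − w₂η are positive semidefinite with nontrivial kernels. Then: (a) no nonzero vector lies in both kernels; (b) every nonzero vector n₁ in the kernel of Q₀ − w₁η satisfies n₁·n₁ < 0 (space-like), and every nonzero vector n₂ in the kernel of Q₀ − w₂η satisfies n₂·n₂ > 0 (time-like), where x·y = x₀y₀ − x₁y₁ − x₂y₂ − x₃y₃ is the Minkowski inner product. -/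
open scoped Matrix ComplexOrder
open Matrix

/-- The Minkowski metric matrix η = diag(1,−1,−1,−1). -/
def etaM : Matrix (Fin 4) (Fin 4) ℝ := Matrix.diagonal ![1, -1, -1, -1]

theorem etaM_mulVec_eq_zero {v : Fin 4 → ℝ} (h : etaM *ᵥ v = 0) : v = 0 := by
  funext i
  have hi := congrFun h i
  rw [etaM, mulVec_diagonal] at hi
  fin_cases i <;> simpa using hi

theorem dotProduct_etaM_mulVec (v : Fin 4 → ℝ) : v ⬝ᵥ (etaM *ᵥ v) = mink v v := by
  simp [etaM, mulVec_diagonal, dotProduct, Fin.sum_univ_four, mink]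
  ring

/-- Moving along the pencil `Q - w • η` away from a kernel vector at `w = a`. -/
theorem pencil_mulVec_of_mem_ker {Q : Matrix (Fin 4) (Fin 4) ℝ} {a : ℝ} {v : Fin 4 → ℝ}
    (ha : (Q - a • etaM) *ᵥ v = 0) (b : ℝ) :
    (Q - b • etaM) *ᵥ v = (a - b) • (etaM *ᵥ v) := by
  rw [sub_mulVec, smul_mulVec, sub_eq_zero] at ha
  rw [sub_mulVec, smul_mulVec, ha, sub_smul]

theorem eq_zero_of_mem_ker_pencil {Q : Matrix (Fin 4) (Fin 4) ℝ} {a b : ℝ} (hab : a ≠ b)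
    {v : Fin 4 → ℝ} (ha : (Q - a • etaM) *ᵥ v = 0) (hb : (Q - b • etaM) *ᵥ v = 0) :
    v = 0 := by
  rw [pencil_mulVec_of_mem_ker ha b] at hb
  exact etaM_mulVec_eq_zero ((smul_eq_zero.mp hb).resolve_left (sub_ne_zero.mpr hab))

theorem sub_mul_mink_pos_of_mem_ker_pencil {Q : Matrix (Fin 4) (Fin 4) ℝ} {a b : ℝ}
    (hab : a ≠ b) (hpsd : (Q - b • etaM).PosSemidef) {v : Fin 4 → ℝ} (hv : v ≠ 0)
    (ha : (Q - a • etaM) *ᵥ v = 0) : 0 < (a - b) * mink v v := by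
  have hq : star v ⬝ᵥ ((Q - b • etaM) *ᵥ v) = (a - b) * mink v v := by
    rw [pencil_mulVec_of_mem_ker ha b, star_trivial, dotProduct_smul, dotProduct_etaM_mulVec,
      smul_eq_mul]
  rw [← hq]
  refine (hpsd.dotProduct_mulVec_nonneg v).lt_of_ne' fun h => hv ?_
  exact eq_zero_of_mem_ker_pencil hab ha ((hpsd.dotProduct_mulVec_zero_iff v).mp h)

/-- if w₁ < w₂ and both Q₀ − w₁η and Q₀ − w₂η are positive semidefinite
with nontrivial kernels, then (a) the kernels intersect trivially; (b) every nonzero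
kernel vector of Q₀ − w₁η is space-like and every nonzero kernel vector of Q₀ − w₂η
is time-like. -/
theorem stmt11 (Q₀ : Matrix (Fin 4) (Fin 4) ℝ) (hsymm : Q₀.IsSymm)
    (w₁ w₂ : ℝ) (h12 : w₁ < w₂)
    (hpsd1 : (Q₀ - w₁ • etaM).PosSemidef) (hpsd2 : (Q₀ - w₂ • etaM).PosSemidef)
    (hker1 : ∃ v : Fin 4 → ℝ, v ≠ 0 ∧ (Q₀ - w₁ • etaM).mulVec v = 0)
    (hker2 : ∃ v : Fin 4 → ℝ, v ≠ 0 ∧ (Q₀ - w₂ • etaM).mulVec v = 0) :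
    (∀ v : Fin 4 → ℝ, (Q₀ - w₁ • etaM).mulVec v = 0 → (Q₀ - w₂ • etaM).mulVec v = 0 →
      v = 0) ∧
    (∀ n₁ : Fin 4 → ℝ, n₁ ≠ 0 → (Q₀ - w₁ • etaM).mulVec n₁ = 0 → mink n₁ n₁ < 0) ∧
    (∀ n₂ : Fin 4 → ℝ, n₂ ≠ 0 → (Q₀ - w₂ • etaM).mulVec n₂ = 0 → 0 < mink n₂ n₂) := by
  refine ⟨fun v h₁ h₂ => eq_zero_of_mem_ker_pencil h12.ne h₁ h₂, fun n₁ hn₁ h₁ => ?_,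
    fun n₂ hn₂ h₂ => ?_⟩
  · have h := sub_mul_mink_pos_of_mem_ker_pencil h12.ne hpsd2 hn₁ h₁
    exact (neg_iff_neg_of_mul_pos h).mp (sub_neg.mpr h12)
  · have h := sub_mul_mink_pos_of_mem_ker_pencil h12.ne' hpsd1 hn₂ h₂
    exact (pos_iff_pos_of_mul_pos h).mp (sub_pos.mpr h12)
end

section
/- (Axially symmetric channels) Let Φ be the positive trace-preserving map on Hermitian 2×2 matrices given by Φ(ρ)₀₀ = α ρ₀₀ + (1−γ)ρ₁₁, Φ(ρ)₁₁ = γ ρ₁₁ + (1−α)ρ₀₀, Φ(ρ)₀₁ = β ρ₀₁, Φ(ρ)₁₀ = β ρ₁₀, with 0 ≤ α, γ ≤ 1 and β real, and assume Φ is a positive map. Set β_c² = 1 + 2αγ − α − γ − 2√(α(1−α)γ(1−γ)) and w = max(β², β_c²). Then Q_w, the matrix of the quadratic form q_w(x) = Φ(x)·Φ(x) − w x·x, is positive semidefinite with nontrivial kernel containing a nonzero vector n with n·n ≤ 0, and for every qubit state ρ with vector x the concurrence is C_Φ(ρ) = √(q_w(x)). -/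
open scoped Matrix ComplexOrder
open Matrix

theorem toMat_det_re (x : Fin 4 → ℝ) : (toMat x).det.re = mink x x / 4 := by
  simp [toMat, pauli1, pauli2, pauli3, mink, Matrix.det_fin_two]
  ring

theorem toMat_trace_re (x : Fin 4 → ℝ) : (toMat x).trace.re = x 0 := by
  simp [toMat, pauli1, pauli2, pauli3, Matrix.trace_fin_two]
  ring

theorem toMat_posSemidef_iff (x : Fin 4 → ℝ) :
    (toMat x).PosSemidef ↔ 0 ≤ x 0 ∧ 0 ≤ mink x x := by
  constructor
  · intro h
    have h1 := (Complex.le_def.mp h.trace_nonneg).1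
    have h2 := (Complex.le_def.mp h.det_nonneg).1
    rw [toMat_trace_re] at h1
    rw [toMat_det_re] at h2
    simp only [Complex.zero_re] at h1 h2
    exact ⟨h1, by linarith⟩
  · rintro ⟨h0, hm⟩
    refine Matrix.PosSemidef.of_dotProduct_mulVec_nonneg ?_ fun v => ?_
    · ext i j
      fin_cases i <;> fin_cases j <;>
        simp [toMat, pauli1, pauli2, pauli3, Complex.ext_iff]
      all_goals ring
    · unfold mink at hm
      have h3 : |x 3| ≤ x 0 := abs_le_of_sq_le_sq (by nlinarith [sq_nonneg (x 1), sq_nonneg (x 2)]) h0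
      obtain ⟨hP, hN⟩ := abs_le.mp h3
      set a := (v 0).re with ha
      set b := (v 0).im with hb
      set c := (v 1).re with hc
      set d := (v 1).im with hd
      have hre : |2 * (x 1 * (a * c + b * d) + x 2 * (a * d - b * c))| ≤
          (x 0 + x 3) * (a ^ 2 + b ^ 2) + (x 0 - x 3) * (c ^ 2 + d ^ 2) := by
        have hU : 0 ≤ a ^ 2 + b ^ 2 := by positivity
        have hV : 0 ≤ c ^ 2 + d ^ 2 := by positivity
        refine abs_le_of_sq_le_sq ?_ (add_nonneg (mul_nonneg (by linarith) hU)
          (mul_nonneg (by linarith) hV))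
        have hUV := mul_nonneg hm (mul_nonneg hU hV)
        nlinarith [sq_nonneg ((x 0 + x 3) * (a ^ 2 + b ^ 2) - (x 0 - x 3) * (c ^ 2 + d ^ 2)),
          sq_nonneg (x 2 * (a * c + b * d) - x 1 * (a * d - b * c))]
      have hre' := (abs_le.mp hre).1
      rw [Complex.le_def]
      constructor
      · simp [toMat, pauli1, pauli2, pauli3, Matrix.mulVec, dotProduct, Fin.sum_univ_two,
          ← ha, ← hb, ← hc, ← hd]
        linarith
      · simp [toMat, pauli1, pauli2, pauli3, Matrix.mulVec, dotProduct, Fin.sum_univ_two,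
          ← ha, ← hb, ← hc, ← hd]
        ring

theorem pureConc_eq (t : Fin 3 → ℝ) (Λ : Matrix (Fin 3) (Fin 3) ℝ) (w : ℝ) {y : Fin 4 → ℝ}
    (hy : mink y y = 0) : pureConc t Λ y = √(qform t Λ w y) := by
  rw [pureConc, toMat_det_re, qform, hy, mul_zero, sub_zero,
    Real.sqrt_div' _ (by norm_num : (0 : ℝ) ≤ 4),
    show (4 : ℝ) = 2 ^ 2 by norm_num, Real.sqrt_sq (by norm_num)]
  ring

/-- A vector with positive Minkowski product with a timelike forward vector, and itself null,
is forward. -/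
theorem zero_pos_of_mink_pos {x y : Fin 4 → ℝ} (hx0 : 0 < x 0) (hx : 0 ≤ mink x x)
    (hy : mink y y = 0) (hxy : 0 < mink x y) : 0 < y 0 := by
  by_contra! h
  unfold mink at *
  have key : |x 1 * y 1 + x 2 * y 2 + x 3 * y 3| ≤ x 0 * -y 0 := by
    refine abs_le_of_sq_le_sq ?_ (mul_nonneg hx0.le (by linarith))
    have := mul_nonneg hx (sq_nonneg (y 0))
    nlinarith [sq_nonneg (x 1 * y 2 - x 2 * y 1), sq_nonneg (x 1 * y 3 - x 3 * y 1),
      sq_nonneg (x 2 * y 3 - x 3 * y 2)]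
  linarith [(abs_le.mp key).1]

theorem mink_add_smul (x n : Fin 4 → ℝ) (s : ℝ) :
    mink (x + s • n) (x + s • n) = mink x x + 2 * s * mink x n + s ^ 2 * mink n n := by
  simp [mink]
  ring

theorem mink_right_add_smul (x n : Fin 4 → ℝ) (s : ℝ) :
    mink x (x + s • n) = mink x x + s * mink x n := by
  simp [mink]
  ring

theorem mink_smul_smul (n : Fin 4 → ℝ) (s : ℝ) :
    mink (s • n) (s • n) = s ^ 2 * mink n n := by
  simp [mink]
  ring

theorem mink_right_smul (x n : Fin 4 → ℝ) (s : ℝ) : mink x (s • n) = s * mink x n := by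
  simp [mink]
  ring

/-- A forward timelike vector is not Minkowski-orthogonal to a nonzero null vector. -/
theorem mink_ne_zero_of_null {x n : Fin 4 → ℝ} (hx : 0 < mink x x)
    (hn : mink n n = 0) (hn0 : n ≠ 0) : mink x n ≠ 0 := by
  intro h
  unfold mink at *
  have key : (x 0 * x 0 - x 1 * x 1 - x 2 * x 2 - x 3 * x 3) * (n 0) ^ 2 ≤ 0 := by
    have : (x 1 * n 1 + x 2 * n 2 + x 3 * n 3) ^ 2 = (x 0 * n 0) ^ 2 := by
      congr 1
      linarith
    nlinarith [sq_nonneg (x 1 * n 2 - x 2 * n 1), sq_nonneg (x 1 * n 3 - x 3 * n 1),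
      sq_nonneg (x 2 * n 3 - x 3 * n 2)]
  have h0 : n 0 = 0 := by
    by_contra h0
    have : 0 < n 0 ^ 2 := by positivity
    nlinarith
  rw [h0] at hn
  apply hn0
  ext i
  fin_cases i
  · exact h0
  all_goals
    simp only [Pi.zero_apply]
    apply pow_eq_zero_iff (two_ne_zero) |>.mp
    simp only [Fin.reduceFinMk, Fin.mk_one]
    nlinarith [sq_nonneg (n 1), sq_nonneg (n 2), sq_nonneg (n 3)]

/-- Optimal two-point decomposition along a direction `n` in which `q` is constant. -/
theorem exists_null_decomposition (q : (Fin 4 → ℝ) → ℝ) {x n : Fin 4 → ℝ} (hx0 : 0 < x 0)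
    (hx : 0 ≤ mink x x) (hn0 : n ≠ 0) (hn : mink n n ≤ 0)
    (hq : ∀ s : ℝ, q (x + s • n) = q x) (hqn : ∀ s : ℝ, q (s • n) = 0) :
    ∃ (c : Fin 2 → ℝ) (y : Fin 2 → Fin 4 → ℝ), (∀ j, 0 < c j) ∧ (∀ j, 0 < y j 0) ∧
      (∀ j, mink (y j) (y j) = 0) ∧ (∀ i, ∑ j, c j * y j i = x i) ∧
      ∑ j, c j * √(q (y j)) = √(q x) := by
  rcases hx.eq_or_lt with hx | hx
  · refine ⟨fun _ => 1 / 2, fun _ => x, by simp, fun _ => hx0, fun _ => hx.symm, ?_, ?_⟩ <;>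
      simp
  rcases hn.eq_or_lt with hn | hn
  · have hxn := mink_ne_zero_of_null hx hn hn0
    set s := -mink x x / (2 * mink x n) with hs
    have hsx : s * mink x n = -mink x x / 2 := by
      rw [hs]
      field_simp
    have h1 : mink (x + s • n) (x + s • n) = 0 := by
      rw [mink_add_smul, hn]
      linarith
    have h2 : mink ((-s) • n) ((-s) • n) = 0 := by rw [mink_smul_smul, hn, mul_zero]
    refine ⟨fun _ => 1, ![x + s • n, (-s) • n], by simp, ?_, ?_, ?_, ?_⟩
    · rw [Fin.forall_fin_two]
      refine ⟨zero_pos_of_mink_pos hx0 hx.le h1 ?_, zero_pos_of_mink_pos hx0 hx.le h2 ?_⟩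
      · rw [Matrix.cons_val_zero, mink_right_add_smul]
        linarith
      · rw [Matrix.cons_val_one, Matrix.cons_val_zero, mink_right_smul]
        linarith
    · rw [Fin.forall_fin_two]
      exact ⟨h1, h2⟩
    · intro i
      simp [Fin.sum_univ_two]
    · rw [Fin.sum_univ_two]
      simp only [Matrix.cons_val_zero, Matrix.cons_val_one, hq, hqn]
      simp
  · set N := -mink n n with hN
    set b := mink x n with hb
    set r := √(b ^ 2 + N * mink x x) with hr
    have hNpos : 0 < N := by linarith
    have hNx : 0 < N * mink x x := mul_pos hNpos hx
    have hr2 : r ^ 2 = b ^ 2 + N * mink x x := Real.sq_sqrt (by positivity)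
    have hbr : |b| < r := abs_lt_of_sq_lt_sq (by linarith) (Real.sqrt_nonneg _)
    obtain ⟨hbr1, hbr2⟩ := abs_lt.mp hbr
    have hrpos : 0 < r := by linarith
    have hnull : ∀ e : ℝ, e ^ 2 = r ^ 2 →
        mink (x + ((b + e) / N) • n) (x + ((b + e) / N) • n) = 0 := by
      intro e he
      rw [mink_add_smul, show mink n n = -N by simp [hN], ← hb]
      field_simp
      linarith
    have hfwd : ∀ e : ℝ, e ^ 2 = r ^ 2 → 0 < (x + ((b + e) / N) • n) 0 := by
      intro e he
      refine zero_pos_of_mink_pos hx0 hx.le (hnull e he) ?_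
      have h1 := hnull e he
      rw [mink_add_smul] at h1
      rw [mink_right_add_smul]
      nlinarith [mul_nonneg (sq_nonneg ((b + e) / N)) hNpos.le]
    refine ⟨![(r - b) / (2 * r), (r + b) / (2 * r)],
      ![x + ((b + r) / N) • n, x + ((b + -r) / N) • n], ?_, ?_, ?_, ?_, ?_⟩
    · rw [Fin.forall_fin_two]
      exact ⟨div_pos (by linarith) (by linarith), div_pos (by linarith) (by linarith)⟩
    · rw [Fin.forall_fin_two]
      exact ⟨hfwd r rfl, hfwd (-r) (by ring)⟩
    · rw [Fin.forall_fin_two]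
      exact ⟨hnull r rfl, hnull (-r) (by ring)⟩
    · intro i
      simp [Fin.sum_univ_two]
      field_simp
      ring
    · rw [Fin.sum_univ_two]
      simp only [Matrix.cons_val_zero, Matrix.cons_val_one, hq]
      field_simp
      ring

/-- The symmetric bilinear forms on `ℝ⁴` that are invariant under rotations about the third
axis and even in the first two coordinates. -/
def axialForm (a A B D : ℝ) (x y : Fin 4 → ℝ) : ℝ :=
  a * (x 1 * y 1 + x 2 * y 2) + A * (x 0 * y 0) + B * (x 0 * y 3 + x 3 * y 0) + D * (x 3 * y 3)

theorem axialForm_self_nonneg {a A B D : ℝ} (ha : 0 ≤ a) (hA : 0 ≤ A) (hD : 0 ≤ D)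
    (hB : B ^ 2 ≤ A * D) (x : Fin 4 → ℝ) : 0 ≤ axialForm a A B D x x := by
  have h1 : 0 ≤ a * (x 1 * x 1 + x 2 * x 2) :=
    mul_nonneg ha (add_nonneg (mul_self_nonneg _) (mul_self_nonneg _))
  have h2 : |2 * B * (x 0 * x 3)| ≤ A * x 0 ^ 2 + D * x 3 ^ 2 := by
    refine abs_le_of_sq_le_sq ?_ (by positivity)
    nlinarith [sq_nonneg (A * x 0 ^ 2 - D * x 3 ^ 2),
      mul_le_mul_of_nonneg_right hB (sq_nonneg (x 0 * x 3))]
  have h3 := (abs_le.mp h2).1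
  unfold axialForm
  linarith

theorem axialForm_smul_self (a A B D s : ℝ) (x : Fin 4 → ℝ) :
    axialForm a A B D (s • x) (s • x) = s ^ 2 * axialForm a A B D x x := by
  simp [axialForm]
  ring

theorem axialForm_sum_right (a A B D : ℝ) (x : Fin 4 → ℝ) {k : ℕ} (p : Fin k → ℝ)
    (y : Fin k → Fin 4 → ℝ) :
    axialForm a A B D x (fun i => ∑ j, p j * y j i) =
      ∑ j, p j * axialForm a A B D x (y j) := by
  simp only [axialForm, Finset.mul_sum, ← Finset.sum_add_distrib]
  exact Finset.sum_congr rfl fun j _ => by ring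

theorem axialForm_le_sqrt_mul_sqrt {a A B D : ℝ} (h : ∀ x, 0 ≤ axialForm a A B D x x)
    {x : Fin 4 → ℝ} (hx : 0 < axialForm a A B D x x) (y : Fin 4 → ℝ) :
    axialForm a A B D x y ≤ √(axialForm a A B D x x) * √(axialForm a A B D y y) := by
  rw [← Real.sqrt_mul (h x)]
  refine Real.le_sqrt_of_sq_le ?_
  have key := h (axialForm a A B D x x • y - axialForm a A B D x y • x)
  have e : axialForm a A B D (axialForm a A B D x x • y - axialForm a A B D x y • x)
      (axialForm a A B D x x • y - axialForm a A B D x y • x) =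
      axialForm a A B D x x *
        (axialForm a A B D x x * axialForm a A B D y y - axialForm a A B D x y ^ 2) := by
    generalize hX : axialForm a A B D x x = X
    generalize hY : axialForm a A B D x y = Y
    have : axialForm a A B D (X • y - Y • x) (X • y - Y • x) =
        X ^ 2 * axialForm a A B D y y - 2 * X * Y * axialForm a A B D x y +
          Y ^ 2 * axialForm a A B D x x := by
      simp [axialForm]
      ring
    rw [this, hX, hY]
    ring
  rw [e] at key
  linarith [nonneg_of_mul_nonneg_right key hx]

theorem sqrt_axialForm_sum_le {a A B D : ℝ} (h : ∀ x, 0 ≤ axialForm a A B D x x)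
    {x : Fin 4 → ℝ} {k : ℕ} {p : Fin k → ℝ} (hp : ∀ j, 0 < p j) {y : Fin k → Fin 4 → ℝ}
    (hx : ∀ i, ∑ j, p j * y j i = x i) :
    √(axialForm a A B D x x) ≤ ∑ j, p j * √(axialForm a A B D (y j) (y j)) := by
  rcases (h x).eq_or_lt with h0 | h0
  · rw [← h0, Real.sqrt_zero]
    exact Finset.sum_nonneg fun j _ => mul_nonneg (hp j).le (Real.sqrt_nonneg _)
  have hs := Real.sqrt_pos.mpr h0
  refine le_of_mul_le_mul_left ?_ hs
  calc √(axialForm a A B D x x) * √(axialForm a A B D x x)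
      = axialForm a A B D x (fun i => ∑ j, p j * y j i) := by
        rw [Real.mul_self_sqrt (h x), funext hx]
    _ = ∑ j, p j * axialForm a A B D x (y j) := axialForm_sum_right ..
    _ ≤ ∑ j, p j * (√(axialForm a A B D x x) * √(axialForm a A B D (y j) (y j))) :=
        Finset.sum_le_sum fun j _ =>
          mul_le_mul_of_nonneg_left (axialForm_le_sqrt_mul_sqrt h h0 (y j)) (hp j).le
    _ = √(axialForm a A B D x x) * ∑ j, p j * √(axialForm a A B D (y j) (y j)) := by
        rw [Finset.mul_sum]
        exact Finset.sum_congr rfl fun j _ => by ring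

theorem qform_axial (δ μ β w : ℝ) (x : Fin 4 → ℝ) :
    qform ![0, 0, δ] (Matrix.diagonal ![β, β, μ]) w x =
      axialForm (w - β ^ 2) (1 - δ ^ 2 - w) (-(δ * μ)) (w - μ ^ 2) x x := by
  simp [qform, phiVec, mink, axialForm, Matrix.diagonal_apply, Fin.succ]
  ring

/-- The form `q` is a squared seminorm with a kernel vector that is not timelike, so the convex
roof of its square root is attained on a two-point decomposition along that vector. -/
theorem conc_eq_sqrt_of_axialForm (t : Fin 3 → ℝ) (Λ : Matrix (Fin 3) (Fin 3) ℝ)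
    {w a A B D : ℝ} (hq : ∀ x, qform t Λ w x = axialForm a A B D x x)
    (h : ∀ x, 0 ≤ axialForm a A B D x x) {n : Fin 4 → ℝ} (hn0 : n ≠ 0) (hn : mink n n ≤ 0)
    (hker : ∀ x (s : ℝ), axialForm a A B D (x + s • n) (x + s • n) = axialForm a A B D x x)
    {x : Fin 4 → ℝ} (hx : IsStateVec x) : conc t Λ x = √(qform t Λ w x) := by
  obtain ⟨hpsd, hx1⟩ := hx
  have hxm := ((toMat_posSemidef_iff x).mp hpsd).2
  refine IsLeast.csInf_eq ⟨?_, ?_⟩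
  · obtain ⟨c, y, hc, hy0, hy, hsum, hval⟩ :=
      exists_null_decomposition (fun x => axialForm a A B D x x) (by rw [hx1]; norm_num) hxm
        hn0 hn (hker x) (fun s => by
          have := hker 0 s
          rw [zero_add] at this
          rw [this]
          simp [axialForm])
    have hnull : ∀ j, mink ((y j 0)⁻¹ • y j) ((y j 0)⁻¹ • y j) = 0 := fun j => by
      rw [mink_smul_smul, hy, mul_zero]
    have hone : ∀ j, ((y j 0)⁻¹ • y j) 0 = 1 := fun j => by
      simp [(hy0 j).ne']
    refine ⟨2, fun j => c j * y j 0, fun j => (y j 0)⁻¹ • y j, fun j => mul_pos (hc j) (hy0 j),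
      (hsum 0).trans hx1, fun j => ⟨(toMat_posSemidef_iff _).mpr ⟨?_, (hnull j).ge⟩, hone j,
      hnull j⟩, fun i => ?_, ?_⟩
    · exact zero_le_one.trans_eq (hone j).symm
    · rw [← hsum i]
      refine Finset.sum_congr rfl fun j _ => ?_
      have := (hy0 j).ne'
      simp only [Pi.smul_apply, smul_eq_mul]
      field_simp
    · rw [hq, ← hval]
      refine Finset.sum_congr rfl fun j _ => ?_
      have := (hy0 j).ne'
      rw [pureConc_eq t Λ w (hnull j), hq, axialForm_smul_self, Real.sqrt_mul (sq_nonneg _),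
        Real.sqrt_sq (inv_pos.mpr (hy0 j)).le]
      field_simp
  · rintro _ ⟨k, p, y, hp, -, hy, hsum, rfl⟩
    rw [hq]
    refine (sqrt_axialForm_sum_le h hp hsum).trans_eq (Finset.sum_congr rfl fun j _ => ?_)
    rw [pureConc_eq t Λ w (hy j).2.2, hq]

/-- If `a² u² + g² v² ≥ K u v` for all positive `u, v`, then `K ≤ 2 a g`. -/
theorem le_two_mul_of_forall_pos {a g K : ℝ} (ha : 0 ≤ a) (hg : 0 ≤ g)
    (h : ∀ u v : ℝ, 0 < u → 0 < v → K * (u * v) ≤ a ^ 2 * u ^ 2 + g ^ 2 * v ^ 2) :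
    K ≤ 2 * a * g := by
  by_contra! hK
  have key : ∀ ε : ℝ, 0 < ε → (K - 2 * a * g) * (ε + (a + g)) ≤ ε * (a - g) ^ 2 := by
    intro ε hε
    have h1 := h (g + ε) (a + ε) (by linarith) (by linarith)
    have h2 : 0 ≤ (K - 2 * a * g) * (a * g) := mul_nonneg (by linarith) (by positivity)
    refine le_of_mul_le_mul_left ?_ hε
    nlinarith
  rcases (add_nonneg ha hg).eq_or_lt with hS | hS
  · have ha0 : a = 0 := by linarith
    have hg0 : g = 0 := by linarith
    subst ha0 hg0
    linarith [key 1 one_pos]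
  · have hk : 0 < K - 2 * a * g := by linarith
    have h1 := key ((K - 2 * a * g) / (2 * (a + g))) (by positivity)
    have h2 : (K - 2 * a * g) / (2 * (a + g)) * (a - g) ^ 2 ≤
        (K - 2 * a * g) / (2 * (a + g)) * (a + g) ^ 2 :=
      mul_le_mul_of_nonneg_left (by nlinarith) (by positivity)
    have h3 : (K - 2 * a * g) / (2 * (a + g)) * (a + g) ^ 2 = (K - 2 * a * g) * (a + g) / 2 := by
      field_simp
    have h4 : 0 < (K - 2 * a * g) / (2 * (a + g)) := by positivity
    nlinarith [mul_pos hk hS, mul_pos hk h4]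

theorem IsPosMap.sq_le {α γ β : ℝ} (hα0 : 0 ≤ α) (hα1 : α ≤ 1) (hγ0 : 0 ≤ γ) (hγ1 : γ ≤ 1)
    (hpos : IsPosMap ![0, 0, α - γ] (Matrix.diagonal ![β, β, α + γ - 1])) :
    β ^ 2 ≤ 1 + 2 * α * γ - α - γ + 2 * √(α * (1 - α) * γ * (1 - γ)) := by
  have hA : 0 ≤ α * (1 - α) := mul_nonneg hα0 (by linarith)
  have hG : 0 ≤ γ * (1 - γ) := mul_nonneg hγ0 (by linarith)
  rw [mul_assoc (α * (1 - α)), Real.sqrt_mul hA]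
  have := le_two_mul_of_forall_pos (K := β ^ 2 - (1 + 2 * α * γ - α - γ))
    (Real.sqrt_nonneg (α * (1 - α))) (Real.sqrt_nonneg (γ * (1 - γ))) ?_
  · linarith
  intro u v hu hv
  rw [Real.sq_sqrt hA, Real.sq_sqrt hG]
  have huv : √(u * v) ^ 2 = u * v := Real.sq_sqrt (by positivity)
  have h := ((toMat_posSemidef_iff _).mp (hpos ![u + v, 2 * √(u * v), 0, u - v]
    ((toMat_posSemidef_iff _).mpr ⟨by simp; linarith, by simp [mink]; nlinarith⟩))).2
  have e : mink ![u + v, 2 * √(u * v), 0, u - v] ![u + v, 2 * √(u * v), 0, u - v] = 0 := by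
    simp [mink]
    nlinarith
  have h' := qform_axial (α - γ) (α + γ - 1) β (β ^ 2) ![u + v, 2 * √(u * v), 0, u - v]
  rw [qform, e] at h'
  rw [mul_zero, sub_zero] at h'
  rw [h'] at h
  simp [axialForm] at h
  nlinarith

/-- axially symmetric channels: for the axially symmetric map with
Bloch parameters Λ = diag(β, β, α+γ−1), t⃗ = (0,0,α−γ), 0 ≤ α, γ ≤ 1, assumed positive,
and w = max(β², β_c²) with β_c² = 1 + 2αγ − α − γ − 2√(α(1−α)γ(1−γ)), the matrix Q_w is
positive semidefinite with a nonzero kernel vector n with n·n ≤ 0, and the concurrence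
of every qubit state with vector x is C_Φ(ρ) = √(q_w(x)). -/
theorem stmt15 (α γ β : ℝ) (hα0 : 0 ≤ α) (hα1 : α ≤ 1) (hγ0 : 0 ≤ γ) (hγ1 : γ ≤ 1)
    (t : Fin 3 → ℝ) (ht : t = ![0, 0, α - γ])
    (Λ : Matrix (Fin 3) (Fin 3) ℝ) (hΛ : Λ = Matrix.diagonal ![β, β, α + γ - 1])
    (hpos : IsPosMap t Λ)
    (βc2 : ℝ) (hβc2 : βc2 = 1 + 2*α*γ - α - γ - 2 * Real.sqrt (α*(1-α)*γ*(1-γ)))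
    (w : ℝ) (hw : w = max (β ^ 2) βc2) :
    (∀ Q : Matrix (Fin 4) (Fin 4) ℝ, Q.IsSymm →
      (∀ x : Fin 4 → ℝ, x ⬝ᵥ Q.mulVec x = qform t Λ w x) →
      Q.PosSemidef ∧ ∃ n : Fin 4 → ℝ, n ≠ 0 ∧ Q.mulVec n = 0 ∧ mink n n ≤ 0) ∧
    (∀ x : Fin 4 → ℝ, IsStateVec x →
      conc t Λ x = Real.sqrt (qform t Λ w x)) := by
  subst ht hΛ
  have hβ := hpos.sq_le hα0 hα1 hγ0 hγ1
  have hrad : 0 ≤ α * (1 - α) * γ * (1 - γ) :=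
    mul_nonneg (mul_nonneg (mul_nonneg hα0 (by linarith)) hγ0) (by linarith)
  have hs0 := Real.sqrt_nonneg (α * (1 - α) * γ * (1 - γ))
  have hs2 := Real.sq_sqrt hrad
  set s := √(α * (1 - α) * γ * (1 - γ))
  have hm0 : 0 ≤ 1 + 2 * α * γ - α - γ := by
    nlinarith [mul_nonneg hα0 hγ0, mul_nonneg (sub_nonneg.mpr hα1) (sub_nonneg.mpr hγ1)]
  have hm1 : 0 ≤ α + γ - 2 * α * γ := by
    nlinarith [mul_nonneg hα0 (sub_nonneg.mpr hγ1), mul_nonneg hγ0 (sub_nonneg.mpr hα1)]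
  have hlo : 2 * s ≤ 1 + 2 * α * γ - α - γ :=
    le_of_abs_le (abs_le_of_sq_le_sq (by nlinarith [sq_nonneg (α + γ - 1)]) hm0)
  have hhi : 2 * s ≤ α + γ - 2 * α * γ :=
    le_of_abs_le (abs_le_of_sq_le_sq (by nlinarith [sq_nonneg (α - γ)]) hm1)
  have hprod : βc2 * (1 + 2 * α * γ - α - γ + 2 * s) = (α + γ - 1) ^ 2 := by
    rw [hβc2]
    linear_combination -4 * hs2
  have hc0 : 0 ≤ βc2 := by linarith
  have hμ : (α + γ - 1) ^ 2 ≤ βc2 := by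
    rw [← hprod]
    exact mul_le_of_le_one_right hc0 (by linarith)
  have hwβ : β ^ 2 ≤ w := hw ▸ le_max_left _ _
  have hwc : βc2 ≤ w := hw ▸ le_max_right _ _
  have hwr : w ≤ 1 + 2 * α * γ - α - γ + 2 * s := hw ▸ max_le hβ (by linarith)
  have hdet : (1 - (α - γ) ^ 2 - w) * (w - (α + γ - 1) ^ 2) - (-((α - γ) * (α + γ - 1))) ^ 2 =
      (w - βc2) * (1 + 2 * α * γ - α - γ + 2 * s - w) := by
    rw [hβc2]
    linear_combination -4 * hs2
  have hD : 0 ≤ w - (α + γ - 1) ^ 2 := by linarith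
  have hA : 0 ≤ 1 - (α - γ) ^ 2 - w := by nlinarith
  have hB : (-((α - γ) * (α + γ - 1))) ^ 2 ≤
      (1 - (α - γ) ^ 2 - w) * (w - (α + γ - 1) ^ 2) := by
    linarith [mul_nonneg (sub_nonneg.mpr hwc) (sub_nonneg.mpr hwr)]
  have hpsd := axialForm_self_nonneg (sub_nonneg.mpr hwβ) hA hD hB
  have hq := qform_axial (α - γ) (α + γ - 1) β w
  obtain ⟨n, hn0, hn, hker⟩ : ∃ n : Fin 4 → ℝ, n ≠ 0 ∧ mink n n ≤ 0 ∧ ∀ x (s : ℝ),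
      axialForm (w - β ^ 2) (1 - (α - γ) ^ 2 - w) (-((α - γ) * (α + γ - 1)))
        (w - (α + γ - 1) ^ 2) (x + s • n) (x + s • n) =
      axialForm (w - β ^ 2) (1 - (α - γ) ^ 2 - w) (-((α - γ) * (α + γ - 1)))
        (w - (α + γ - 1) ^ 2) x x := by
    rcases max_choice (β ^ 2) βc2 with hmax | hmax
    · rw [← hw] at hmax
      refine ⟨![0, 1, 0, 0], fun h => by simpa using congrFun h 1, by simp [mink], fun x s => ?_⟩
      rw [hmax]
      simp [axialForm]
    · rw [← hw] at hmax
      have hAD : (1 - (α - γ) ^ 2 - w) * (w - (α + γ - 1) ^ 2) =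
          (-((α - γ) * (α + γ - 1))) ^ 2 := by
        rw [← sub_eq_zero, hdet, hmax, sub_self, zero_mul]
      have hDA : w - (α + γ - 1) ^ 2 ≤ 1 - (α - γ) ^ 2 - w := by nlinarith
      generalize w - (α + γ - 1) ^ 2 = D at *
      generalize 1 - (α - γ) ^ 2 - w = A at *
      generalize -((α - γ) * (α + γ - 1)) = B at *
      rcases hD.eq_or_lt with rfl | hD
      · have hB : B = 0 := by simpa using hAD.symm
        refine ⟨![0, 0, 0, 1], fun h => by simpa using congrFun h 3, by simp [mink],
          fun x s => ?_⟩
        rw [hB]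
        simp [axialForm]
      · refine ⟨![D, 0, 0, -B], fun h => hD.ne' (by simpa using congrFun h 0), ?_, fun x s => ?_⟩
        · simp [mink]
          nlinarith
        · simp [axialForm]
          linear_combination (2 * s * x 0 + s ^ 2 * D) * hAD
  refine ⟨fun Q hQ hQq => ?_, fun x hx => conc_eq_sqrt_of_axialForm _ _ hq hpsd hn0 hn hker hx⟩
  have hQpsd : Q.PosSemidef := by
    refine Matrix.PosSemidef.of_dotProduct_mulVec_nonneg ?_ fun x => ?_
    · simpa [Matrix.IsHermitian, Matrix.conjTranspose_eq_transpose_of_trivial] using hQ.eq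
    · rw [star_trivial, hQq, hq]
      exact hpsd x
  refine ⟨hQpsd, n, hn0, (hQpsd.dotProduct_mulVec_zero_iff n).mp ?_, hn⟩
  have h0 := hker 0 1
  rw [zero_add, one_smul] at h0
  rw [star_trivial, hQq, hq, h0]
  simp [axialForm]
end

section
/- (Theorem 1, part) Let g be a continuous real-valued function on the set of pure qubit states, and for each qubit state ρ define G(ρ) = inf { Σ pⱼ g(πⱼ) : ρ = Σ pⱼ πⱼ a finite convex combination of pure states πⱼ with pⱼ > 0, Σ pⱼ = 1 }. Then G is a convex function on the set of qubit states, and the infimum is attained: for every qubit state ρ there exists a finite convex decomposition ρ = Σ pⱼ πⱼ into pure states with G(ρ) = Σ pⱼ g(πⱼ) (G is a roof). -/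
open scoped Matrix ComplexOrder
open Matrix

/-- The set of qubit states: positive semidefinite Hermitian 2×2 matrices of trace 1. -/
def StateQ : Set (Matrix (Fin 2) (Fin 2) ℂ) := {ρ | ρ.PosSemidef ∧ ρ.trace = 1}

/-- The set of pure qubit states: states of determinant 0. -/
def PureQ : Set (Matrix (Fin 2) (Fin 2) ℂ) :=
  {π | π.PosSemidef ∧ π.trace = 1 ∧ π.det = 0}

/-- The convex-roof extension G(ρ) = inf { Σ pⱼ g(πⱼ) : ρ = Σ pⱼ πⱼ, πⱼ pure }. -/
noncomputable def roofExt (g : Matrix (Fin 2) (Fin 2) ℂ → ℝ)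
    (ρ : Matrix (Fin 2) (Fin 2) ℂ) : ℝ :=
  sInf {c : ℝ | ∃ (k : ℕ) (p : Fin k → ℝ) (π : Fin k → Matrix (Fin 2) (Fin 2) ℂ),
    (∀ j, 0 < p j) ∧ (∑ j, p j) = 1 ∧ (∀ j, π j ∈ PureQ) ∧
    ρ = ∑ j, (p j : ℂ) • π j ∧ c = ∑ j, p j * g (π j)}

/-- In a finite-dimensional space, the convex hull of a compact set is compact. -/
theorem isCompact_convexHull_of_finiteDimensional {E : Type*} [AddCommGroup E] [Module ℝ E]
    [TopologicalSpace E] [ContinuousAdd E] [ContinuousSMul ℝ E] [FiniteDimensional ℝ E]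
    {s : Set E} (hs : IsCompact s) : IsCompact (convexHull ℝ s) := by
  rcases s.eq_empty_or_nonempty with rfl | ⟨x₀, hx₀⟩
  · simp
  let N := Module.finrank ℝ E + 1
  let F : (Fin N → ℝ) × (Fin N → E) → E := fun q => ∑ i, q.1 i • q.2 i
  have hF : Continuous F := by fun_prop
  have hK : IsCompact (stdSimplex ℝ (Fin N) ×ˢ Set.pi Set.univ fun _ : Fin N => s) :=
    (isCompact_stdSimplex ℝ (Fin N)).prod (isCompact_univ_pi fun _ => hs)
  convert hK.image hF
  ext x
  constructor
  · intro hx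
    obtain ⟨ι, _, z, w, hz, hind, hw, hw1, hwz⟩ := eq_pos_convex_span_of_mem_convexHull hx
    have hcard : Fintype.card ι ≤ Fintype.card (Fin N) := by
      rw [Fintype.card_fin]
      exact hind.card_le_finrank_succ.trans (Nat.succ_le_succ (Submodule.finrank_le _))
    obtain ⟨e⟩ := Function.Embedding.nonempty_of_card_le hcard
    have hext (i : Fin N) (hi : i ∉ Set.range e) : Function.extend e w 0 i = 0 :=
      Function.extend_apply' _ _ _ hi
    refine ⟨(Function.extend e w 0, Function.extend e z fun _ => x₀), ⟨⟨fun i => ?_, ?_⟩, ?_⟩, ?_⟩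
    · by_cases hi : i ∈ Set.range e
      · obtain ⟨j, rfl⟩ := hi
        simpa [e.injective.extend_apply] using (hw j).le
      · exact (hext i hi).ge
    · rw [← hw1]
      exact (Fintype.sum_of_injective e e.injective _ _ hext
        fun i => (e.injective.extend_apply _ _ _).symm).symm
    · intro i _
      by_cases hi : i ∈ Set.range e
      · obtain ⟨j, rfl⟩ := hi
        simpa [e.injective.extend_apply] using hz ⟨j, rfl⟩
      · simpa [Function.extend_apply' _ _ _ hi] using hx₀
    · rw [← hwz]
      refine (Fintype.sum_of_injective e e.injective _ _ (fun i hi => ?_) fun i => ?_).symm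
      · simp [hext i hi]
      · simp [e.injective.extend_apply]
  · rintro ⟨⟨w, z⟩, ⟨⟨hw, hw1⟩, hz⟩, rfl⟩
    exact (convex_convexHull ℝ s).sum_mem (fun i _ => hw i) hw1
      fun i _ => subset_convexHull ℝ s (hz i trivial)

/-- A Hermitian 2×2 matrix of trace 1 and determinant 0 is a projection. -/
theorem conjTranspose_mul_self_of_trace_one_det_zero {M : Matrix (Fin 2) (Fin 2) ℂ}
    (hM : M.IsHermitian) (ht : M.trace = 1) (hd : M.det = 0) : Mᴴ * M = M := by
  rw [hM.eq]
  rw [trace_fin_two] at ht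
  rw [det_fin_two] at hd
  ext i j
  fin_cases i <;> fin_cases j <;> simp only [mul_apply, Fin.sum_univ_two] <;> simp <;>
    [linear_combination M 0 0 * ht - hd; linear_combination M 0 1 * ht;
     linear_combination M 1 0 * ht; linear_combination M 1 1 * ht - hd]

theorem mem_PureQ_iff {M : Matrix (Fin 2) (Fin 2) ℂ} :
    M ∈ PureQ ↔ M.IsHermitian ∧ M.trace = 1 ∧ M.det = 0 := by
  refine ⟨fun h => ⟨h.1.isHermitian, h.2⟩, fun ⟨hM, ht, hd⟩ => ⟨?_, ht, hd⟩⟩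
  rw [← conjTranspose_mul_self_of_trace_one_det_zero hM ht hd]
  exact posSemidef_conjTranspose_mul_self M

theorem norm_apply_le_one_of_mem_PureQ {M : Matrix (Fin 2) (Fin 2) ℂ} (hM : M ∈ PureQ)
    (i j : Fin 2) : ‖M i j‖ ≤ 1 := by
  obtain ⟨hH, ht, hd⟩ := mem_PureQ_iff.1 hM
  have hP := conjTranspose_mul_self_of_trace_one_det_zero hH ht hd
  have hsum : ‖M 0 0‖ ^ 2 + ‖M 1 0‖ ^ 2 + (‖M 0 1‖ ^ 2 + ‖M 1 1‖ ^ 2) = 1 := by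
    rw [← hP, trace_fin_two] at ht
    simp only [mul_apply, Fin.sum_univ_two, conjTranspose_apply, RCLike.star_def,
      Complex.conj_mul'] at ht
    exact_mod_cast ht
  fin_cases i <;> fin_cases j <;> simp <;>
    nlinarith [sq_nonneg ‖M 0 0‖, sq_nonneg ‖M 0 1‖, sq_nonneg ‖M 1 0‖, sq_nonneg ‖M 1 1‖]

theorem isCompact_PureQ : IsCompact PureQ := by
  have hbox : IsCompact (Set.pi Set.univ fun _ : Fin 2 => Set.pi Set.univ fun _ : Fin 2 =>
      Metric.closedBall (0 : ℂ) 1) :=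
    isCompact_univ_pi fun _ => isCompact_univ_pi fun _ => isCompact_closedBall _ _
  refine IsCompact.of_isClosed_subset (X := Matrix (Fin 2) (Fin 2) ℂ) hbox ?_ fun M hM i _ j _ => ?_
  · have : PureQ = {M | Mᴴ = M} ∩ ({M | M.trace = 1} ∩ {M | M.det = 0}) :=
      Set.ext fun M => mem_PureQ_iff
    rw [this]
    exact (isClosed_eq (by fun_prop) (by fun_prop)).inter
      ((isClosed_eq (by fun_prop) (by fun_prop)).inter (isClosed_eq (by fun_prop) (by fun_prop)))
  · simpa using norm_apply_le_one_of_mem_PureQ hM i j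

theorem convex_StateQ : Convex ℝ StateQ := by
  rintro ρ ⟨hρ, hρt⟩ σ ⟨hσ, hσt⟩ a b ha hb hab
  refine ⟨(hρ.smul ha).add (hσ.smul hb), ?_⟩
  rw [trace_add, trace_smul, trace_smul, hρt, hσt, ← add_smul, hab, one_smul]

theorem StateQ_subset_convexHull_PureQ : StateQ ⊆ convexHull ℝ PureQ := by
  rintro ρ ⟨hρ, ht⟩
  have hH := hρ.isHermitian
  obtain ⟨a, ha⟩ : ∃ a : ℝ, ρ 0 0 = a := ⟨_, (Complex.conj_eq_iff_re.1 (hH.apply 0 0)).symm⟩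
  obtain ⟨x, y, hxy⟩ : ∃ x y : ℝ, ρ 0 1 = x + y * Complex.I :=
    ⟨_, _, (Complex.re_add_im _).symm⟩
  have h10 : ρ 1 0 = x - y * Complex.I := by
    rw [← hH.apply 1 0, hxy]
    simp [sub_eq_add_neg]
  have h11 : ρ 1 1 = 1 - a := by
    rw [trace_fin_two, ha] at ht
    linear_combination ht
  have hdet : y ^ 2 ≤ a * (1 - a) - x ^ 2 := by
    have h := hρ.det_nonneg
    rw [det_fin_two, ha, hxy, h10, h11] at h
    have h' : (0 : ℂ) ≤ ((a * (1 - a) - x ^ 2 - y ^ 2 : ℝ) : ℂ) := by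
      convert h using 1
      push_cast
      linear_combination (-(y : ℂ) ^ 2) * Complex.I_sq
    have := Complex.zero_le_real.1 h'
    linarith
  let P : ℝ → Matrix (Fin 2) (Fin 2) ℂ := fun s =>
    !![(a : ℂ), x + s * Complex.I; x - s * Complex.I, 1 - a]
  have hP (s : ℝ) (hs : s ^ 2 = a * (1 - a) - x ^ 2) : P s ∈ PureQ := by
    refine mem_PureQ_iff.2 ⟨?_, ?_, ?_⟩
    · ext i j
      fin_cases i <;> fin_cases j <;> simp [P, sub_eq_add_neg]
    · simp [P, trace_fin_two]
    · have hs' : (s : ℂ) ^ 2 = a * (1 - a) - x ^ 2 := by exact_mod_cast hs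
      simp only [P, det_fin_two_of]
      linear_combination (s : ℂ) ^ 2 * Complex.I_sq - hs'
  have h0 : 0 ≤ a * (1 - a) - x ^ 2 := (sq_nonneg y).trans hdet
  set r := Real.sqrt (a * (1 - a) - x ^ 2)
  have hy : y ∈ segment ℝ (-r) r := by
    rw [segment_eq_Icc (by linarith [Real.sqrt_nonneg (a * (1 - a) - x ^ 2)])]
    exact abs_le.1 (Real.abs_le_sqrt hdet)
  obtain ⟨u, v, hu, hv, huv, hy⟩ := hy
  have hcomb : u • P (-r) + v • P r = ρ := by
    have huv' : (u : ℂ) + v = 1 := by exact_mod_cast huv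
    have hy' : (u : ℂ) * -r + v * r = y := by exact_mod_cast hy
    ext i j
    fin_cases i <;> fin_cases j <;> simp [P, ha, hxy, h10, h11] <;>
      [linear_combination (a : ℂ) * huv'; linear_combination (x : ℂ) * huv' + Complex.I * hy';
       linear_combination (x : ℂ) * huv' - Complex.I * hy'; linear_combination (1 - a : ℂ) * huv']
  rw [← hcomb]
  exact convex_convexHull ℝ PureQ
    (subset_convexHull ℝ _ (hP _ (by rw [neg_sq, Real.sq_sqrt h0])))
    (subset_convexHull ℝ _ (hP _ (Real.sq_sqrt h0))) hu hv huv

/-- The graph of `g` over the pure states. -/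
def pureGraph (g : Matrix (Fin 2) (Fin 2) ℂ → ℝ) : Set (Matrix (Fin 2) (Fin 2) ℂ × ℝ) :=
  (fun π => (π, g π)) '' PureQ

theorem mem_convexHull_pureGraph_iff {g : Matrix (Fin 2) (Fin 2) ℂ → ℝ}
    {ρ : Matrix (Fin 2) (Fin 2) ℂ} {c : ℝ} :
    (ρ, c) ∈ convexHull ℝ (pureGraph g) ↔
      ∃ (k : ℕ) (p : Fin k → ℝ) (π : Fin k → Matrix (Fin 2) (Fin 2) ℂ),
        (∀ j, 0 < p j) ∧ (∑ j, p j) = 1 ∧ (∀ j, π j ∈ PureQ) ∧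
        ρ = ∑ j, (p j : ℂ) • π j ∧ c = ∑ j, p j * g (π j) := by
  constructor
  · intro h
    obtain ⟨ι, _, z, w, hz, -, hw, hw1, hwz⟩ := eq_pos_convex_span_of_mem_convexHull h
    let e := (Fintype.equivFin ι).symm
    have hz' (i : ι) : (z i).1 ∈ PureQ ∧ g (z i).1 = (z i).2 := by
      obtain ⟨π, hπ, h⟩ := hz ⟨i, rfl⟩
      rw [← h]
      exact ⟨hπ, rfl⟩
    refine ⟨_, w ∘ e, fun j => (z (e j)).1, fun j => hw _, ?_, fun j => (hz' _).1, ?_, ?_⟩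
    · rw [← hw1]
      exact e.sum_comp w
    · have := congrArg Prod.fst hwz
      rw [Prod.fst_sum] at this
      simp only [Function.comp_apply, Complex.coe_smul]
      rw [e.sum_comp fun i => w i • (z i).1]
      exact this.symm
    · have := congrArg Prod.snd hwz
      rw [Prod.snd_sum] at this
      simp only [Function.comp_apply, (hz' _).2]
      rw [e.sum_comp fun i => w i * (z i).2]
      exact this.symm
  · rintro ⟨k, p, π, hp, hp1, hπ, rfl, rfl⟩
    have h := (convex_convexHull ℝ (pureGraph g)).sum_mem (t := Finset.univ)
      (fun j _ => (hp j).le) hp1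
      fun j _ => subset_convexHull ℝ _ (Set.mem_image_of_mem (fun π => (π, g π)) (hπ j))
    convert h using 1
    ext1
    · simp [Prod.fst_sum]
    · simp [Prod.snd_sum]

theorem roofExt_eq_sInf_convexHull (g : Matrix (Fin 2) (Fin 2) ℂ → ℝ)
    (ρ : Matrix (Fin 2) (Fin 2) ℂ) :
    roofExt g ρ = sInf {c | (ρ, c) ∈ convexHull ℝ (pureGraph g)} := by
  simp only [mem_convexHull_pureGraph_iff]
  rfl

theorem isCompact_convexHull_pureGraph_fiber {g : Matrix (Fin 2) (Fin 2) ℂ → ℝ}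
    (hg : ContinuousOn g PureQ) (ρ : Matrix (Fin 2) (Fin 2) ℂ) :
    IsCompact {c | (ρ, c) ∈ convexHull ℝ (pureGraph g)} := by
  have hK : IsCompact (convexHull ℝ (pureGraph g)) :=
    isCompact_convexHull_of_finiteDimensional
      (isCompact_PureQ.image_of_continuousOn (continuousOn_id.prodMk hg))
  convert (hK.inter_right (isClosed_singleton.preimage continuous_fst (t := {ρ}))).image
    continuous_snd
  ext c
  simp

theorem convexHull_pureGraph_fiber_nonempty (g : Matrix (Fin 2) (Fin 2) ℂ → ℝ)
    {ρ : Matrix (Fin 2) (Fin 2) ℂ} (hρ : ρ ∈ StateQ) :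
    {c | (ρ, c) ∈ convexHull ℝ (pureGraph g)}.Nonempty := by
  have himage : LinearMap.fst ℝ _ ℝ '' pureGraph g = PureQ := by
    simp [pureGraph, Set.image_image]
  have h := StateQ_subset_convexHull_PureQ hρ
  rw [← himage, ← LinearMap.image_convexHull] at h
  obtain ⟨⟨σ, c⟩, hc, rfl⟩ := h
  exact ⟨c, hc⟩

theorem roofExt_mem_convexHull_pureGraph {g : Matrix (Fin 2) (Fin 2) ℂ → ℝ}
    (hg : ContinuousOn g PureQ) {ρ : Matrix (Fin 2) (Fin 2) ℂ} (hρ : ρ ∈ StateQ) :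
    (ρ, roofExt g ρ) ∈ convexHull ℝ (pureGraph g) := by
  rw [roofExt_eq_sInf_convexHull]
  exact (isCompact_convexHull_pureGraph_fiber hg ρ).sInf_mem
    (convexHull_pureGraph_fiber_nonempty g hρ)

/-- Theorem 1, part: for continuous g on pure qubit states, the
convex-roof extension G is convex on the set of qubit states and the infimum is
attained: G is a roof. -/
theorem stmt17 (g : Matrix (Fin 2) (Fin 2) ℂ → ℝ) (hg : ContinuousOn g PureQ) :
    ConvexOn ℝ StateQ (roofExt g) ∧
    (∀ ρ ∈ StateQ, ∃ (k : ℕ) (p : Fin k → ℝ) (π : Fin k → Matrix (Fin 2) (Fin 2) ℂ),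
      (∀ j, 0 < p j) ∧ (∑ j, p j) = 1 ∧ (∀ j, π j ∈ PureQ) ∧
      ρ = ∑ j, (p j : ℂ) • π j ∧ roofExt g ρ = ∑ j, p j * g (π j)) := by
  refine ⟨⟨convex_StateQ, fun ρ hρ σ hσ a b ha hb hab => ?_⟩, fun ρ hρ =>
    mem_convexHull_pureGraph_iff.1 (roofExt_mem_convexHull_pureGraph hg hρ)⟩
  rw [roofExt_eq_sInf_convexHull g (a • ρ + b • σ)]
  exact csInf_le (isCompact_convexHull_pureGraph_fiber hg _).bddBelow
    (convex_convexHull ℝ (pureGraph g) (roofExt_mem_convexHull_pureGraph hg hρ)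
      (roofExt_mem_convexHull_pureGraph hg hσ) ha hb hab)
end
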